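/- arXiv:2103.14478 — 8 statements merged into one kernel-verified Lean document; each statement's English description precedes it below -/
import Mathlib

section
/- Let S be a semigroup and ω a weight on S. Then the function ω̃₁ defined by ω̃₁(s) = sup_{t ∈ S} ω(st)/ω(t) is again a weight on S; that is, ω̃₁(s) > 0 for every s ∈ S and ω̃₁(st) ≤ ω̃₁(s)·ω̃₁(t) for all s, t ∈ S. -/
/-- A weight on a semigroup `S`: strictly positive and submultiplicative. -/
def IsWeight {S : Type*} [Semigroup S] (ω : S → ℝ) : Prop :=
  (∀ s, 0 < ω s) ∧ ∀ s t, ω (s * t) ≤ ω s * ω t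

/-- `wt ω s = ω̃₁(s) = sup_{t ∈ S} ω(st)/ω(t)`. -/
noncomputable def wt {S : Type*} [Semigroup S] (ω : S → ℝ) (s : S) : ℝ :=
  ⨆ t : S, ω (s * t) / ω t

theorem IsWeight.bddAbove_range_div {S : Type*} [Semigroup S] {ω : S → ℝ} (hω : IsWeight ω)
    (s : S) : BddAbove (Set.range fun t : S => ω (s * t) / ω t) := by
  refine ⟨ω s, ?_⟩
  rintro _ ⟨t, rfl⟩
  exact (div_le_iff₀ (hω.1 t)).2 (hω.2 s t)

theorem IsWeight.div_le_wt {S : Type*} [Semigroup S] {ω : S → ℝ} (hω : IsWeight ω) (s t : S) :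
    ω (s * t) / ω t ≤ wt ω s :=
  le_ciSup (hω.bddAbove_range_div s) t

theorem IsWeight.wt_pos {S : Type*} [Semigroup S] {ω : S → ℝ} (hω : IsWeight ω) (s : S) :
    0 < wt ω s :=
  (div_pos (hω.1 _) (hω.1 s)).trans_le (hω.div_le_wt s s)

theorem stmt0 {S : Type*} [Semigroup S] (ω : S → ℝ) (hω : IsWeight ω) :
    (∀ s : S, 0 < wt ω s) ∧ ∀ s t : S, wt ω (s * t) ≤ wt ω s * wt ω t := by
  refine ⟨hω.wt_pos, fun s t => ?_⟩
  have : Nonempty S := ⟨s⟩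
  refine ciSup_le fun u => ?_
  calc ω (s * t * u) / ω u = ω (s * (t * u)) / ω (t * u) * (ω (t * u) / ω u) := by
        rw [mul_assoc, div_mul_div_cancel₀ (hω.1 _).ne']
    _ ≤ wt ω s * wt ω t :=
        mul_le_mul (hω.div_le_wt s _) (hω.div_le_wt t u)
          (div_pos (hω.1 _) (hω.1 _)).le (hω.wt_pos s).le
end

section
/- Let S be a semigroup and ω a weight on S. For all f, g ∈ ℓ¹(S, ω), the convolution f * g lies in ℓ¹(S, ω̃₁) and ‖f * g‖_{ω̃₁} ≤ ‖f‖_{ω̃₁} · ‖g‖_{ω̃₁}; that is, ‖·‖_{ω̃₁} is an algebra norm on ℓ¹(S, ω). -/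
open scoped Classical in
/-- Convolution: `(f * g)(s) = Σ_{(u,v), uv = s} f(u) g(v)`. -/
noncomputable def conv {S : Type*} [Semigroup S] (f g : S → ℂ) (s : S) : ℂ :=
  ∑' p : S × S, if p.1 * p.2 = s then f p.1 * g p.2 else 0

namespace IsWeight

variable {S : Type*} [Semigroup S] {ω : S → ℝ}

lemma div_le (hω : IsWeight ω) (s t : S) : ω (s * t) / ω t ≤ ω s :=
  (div_le_iff₀ (hω.1 t)).2 (hω.2 s t)

lemma div_le_wt_s3 (hω : IsWeight ω) (s t : S) : ω (s * t) / ω t ≤ wt ω s :=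
  le_ciSup (f := fun t => ω (s * t) / ω t) ⟨ω s, Set.forall_mem_range.2 (hω.div_le s)⟩ t

lemma wt_le (hω : IsWeight ω) (s : S) : wt ω s ≤ ω s :=
  have : Nonempty S := ⟨s⟩
  ciSup_le (hω.div_le s)

lemma wt_pos_s3 (hω : IsWeight ω) (s : S) : 0 < wt ω s :=
  (div_pos (hω.1 (s * s)) (hω.1 s)).trans_le (hω.div_le_wt_s3 s s)

lemma wt_mul_le (hω : IsWeight ω) (s t : S) : wt ω (s * t) ≤ wt ω s * wt ω t := by
  have : Nonempty S := ⟨s⟩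
  refine ciSup_le fun r => ?_
  have h : ω (s * t * r) / ω r = ω (s * (t * r)) / ω (t * r) * (ω (t * r) / ω r) := by
    rw [mul_assoc, div_mul_div_cancel₀ (hω.1 _).ne']
  rw [h]
  exact mul_le_mul (hω.div_le_wt_s3 _ _) (hω.div_le_wt_s3 _ _)
    (div_pos (hω.1 _) (hω.1 _)).le (hω.wt_pos_s3 s).le

lemma summable_norm_mul_wt (hω : IsWeight ω) {f : S → ℂ} (hf : Summable fun s => ‖f s‖ * ω s) :
    Summable fun s => ‖f s‖ * wt ω s :=
  hf.of_nonneg_of_le (fun s => mul_nonneg (norm_nonneg _) (hω.wt_pos_s3 s).le)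
    fun s => mul_le_mul_of_nonneg_left (hω.wt_le s) (norm_nonneg _)

end IsWeight

lemma conv_eq_tsum_fiber {S : Type*} [Semigroup S] (f g : S → ℂ) (s : S) :
    conv f g s = ∑' p : {p : S × S // p.1 * p.2 = s}, f p.1.1 * g p.1.2 := by
  classical
  rw [conv]
  refine Eq.trans ?_
    (tsum_subtype {p : S × S | p.1 * p.2 = s} fun p => f p.1 * g p.2).symm
  refine tsum_congr fun p => ?_
  simp [Set.indicator_apply]

/-- If `w` is positive and submultiplicative, the weighted norm of `conv f g s` is at most the sum
of the weighted products over the factorizations of `s`. -/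
lemma norm_conv_mul_le {S : Type*} [Semigroup S] {w : S → ℝ} (hw : IsWeight w)
    (f g : S → ℂ) (s : S)
    (h : Summable fun p : {p : S × S // p.1 * p.2 = s} =>
      ‖f p.1.1‖ * w p.1.1 * (‖g p.1.2‖ * w p.1.2)) :
    ‖conv f g s‖ * w s ≤ ∑' p : {p : S × S // p.1 * p.2 = s},
      ‖f p.1.1‖ * w p.1.1 * (‖g p.1.2‖ * w p.1.2) := by
  have hle (p : {p : S × S // p.1 * p.2 = s}) : ‖f p.1.1 * g p.1.2‖ * w s ≤
      ‖f p.1.1‖ * w p.1.1 * (‖g p.1.2‖ * w p.1.2) := by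
    have h' := hw.2 p.1.1 p.1.2
    rw [p.2] at h'
    rw [norm_mul, mul_mul_mul_comm]
    gcongr
  have hs : Summable fun p : {p : S × S // p.1 * p.2 = s} => ‖f p.1.1 * g p.1.2‖ * w s :=
    h.of_nonneg_of_le (fun p => mul_nonneg (norm_nonneg _) (hw.1 s).le) hle
  have hs' : Summable fun p : {p : S × S // p.1 * p.2 = s} => ‖f p.1.1 * g p.1.2‖ :=
    (summable_mul_right_iff (hw.1 s).ne').1 hs
  calc ‖conv f g s‖ * w s
      ≤ (∑' p : {p : S × S // p.1 * p.2 = s}, ‖f p.1.1 * g p.1.2‖) * w s := by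
        rw [conv_eq_tsum_fiber]
        exact mul_le_mul_of_nonneg_right (norm_tsum_le_tsum_norm hs') (hw.1 s).le
    _ = ∑' p : {p : S × S // p.1 * p.2 = s}, ‖f p.1.1 * g p.1.2‖ * w s := tsum_mul_right.symm
    _ ≤ _ := hs.tsum_le_tsum hle h

lemma summable_conv_and_tsum_le {S : Type*} [Semigroup S] {w : S → ℝ} (hw : IsWeight w)
    {f g : S → ℂ} (hf : Summable fun s => ‖f s‖ * w s) (hg : Summable fun s => ‖g s‖ * w s) :
    (Summable fun s => ‖conv f g s‖ * w s) ∧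
      (∑' s, ‖conv f g s‖ * w s) ≤ (∑' s, ‖f s‖ * w s) * ∑' s, ‖g s‖ * w s := by
  have hnn (f : S → ℂ) (s : S) : 0 ≤ ‖f s‖ * w s := mul_nonneg (norm_nonneg _) (hw.1 s).le
  have hprod : Summable fun p : S × S => ‖f p.1‖ * w p.1 * (‖g p.2‖ * w p.2) :=
    hf.mul_of_nonneg hg (hnn f) (hnn g)
  have hfiber (s : S) : Summable fun p : {p : S × S // p.1 * p.2 = s} =>
      ‖f p.1.1‖ * w p.1.1 * (‖g p.1.2‖ * w p.1.2) :=
    hprod.comp_injective Subtype.val_injective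
  have hsum := ((Equiv.sigmaFiberEquiv fun p : S × S => p.1 * p.2).hasSum_iff.2
    hprod.hasSum).sigma fun s => (hfiber s).hasSum
  have hle (s : S) := norm_conv_mul_le hw f g s (hfiber s)
  have hconv : Summable fun s => ‖conv f g s‖ * w s :=
    hsum.summable.of_nonneg_of_le (hnn _) hle
  refine ⟨hconv, (hconv.tsum_le_tsum hle hsum.summable).trans_eq ?_⟩
  rw [hsum.tsum_eq, hf.tsum_mul_tsum hg hprod]

theorem stmt3 {S : Type*} [Semigroup S] (ω : S → ℝ) (hω : IsWeight ω)
    (f g : S → ℂ) (hf : Summable fun s => ‖f s‖ * ω s)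
    (hg : Summable fun s => ‖g s‖ * ω s) :
    (Summable fun s => ‖conv f g s‖ * wt ω s) ∧
      (∑' s, ‖conv f g s‖ * wt ω s) ≤
        (∑' s, ‖f s‖ * wt ω s) * ∑' s, ‖g s‖ * wt ω s :=
  summable_conv_and_tsum_le ⟨hω.wt_pos_s3, hω.wt_mul_le⟩
    (hω.summable_norm_mul_wt hf) (hω.summable_norm_mul_wt hg)
end

section
/- Let S be a right cancellative semigroup and ω a weight on S satisfying the F-property. Then for every f ∈ ℓ¹(S, ω), ‖f‖_{ω op} = ‖f‖_{ω̃₁}; that is, sup{ ‖f * g‖_ω : g ∈ ℓ¹(S, ω), ‖g‖_ω ≤ 1 } = Σ_{s∈S} |f(s)| ω̃₁(s). -/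
/-- The weighted norm `‖f‖_ω = Σ_s |f(s)| ω(s)`. -/
noncomputable def wnorm {S : Type*} (ω : S → ℝ) (f : S → ℂ) : ℝ :=
  ∑' s, ‖f s‖ * ω s

/-- The operator norm `‖f‖_{ω op} = sup { ‖f * g‖_ω : g ∈ ℓ¹(S,ω), ‖g‖_ω ≤ 1 }`. -/
noncomputable def opW {S : Type*} [Semigroup S] (ω : S → ℝ) (f : S → ℂ) : ℝ :=
  sSup {r : ℝ | ∃ g : S → ℂ,
    (Summable fun s => ‖g s‖ * ω s) ∧ wnorm ω g ≤ 1 ∧ r = wnorm ω (conv f g)}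

/-- `S` is right cancellative: `xs = ys` implies `x = y`. -/
def RightCancellative (S : Type*) [Semigroup S] : Prop :=
  ∀ x y s : S, x * s = y * s → x = y

/-- The F-property of a weight `ω`. -/
def FProp {S : Type*} [Semigroup S] (ω : S → ℝ) : Prop :=
  ∀ (T : Finset S) (r : ℝ), 0 < r → r < 1 →
    ∃ s : S, ∀ t ∈ T, r * wt ω t ≤ ω (t * s) / ω s

section Weight

variable {S : Type*} [Semigroup S] {ω : S → ℝ}

lemma IsWeight.div_le_s8 (hω : IsWeight ω) (s t : S) : ω (s * t) / ω t ≤ ω s :=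
  (div_le_iff₀ (hω.1 t)).2 (hω.2 s t)

lemma IsWeight.wt_nonneg (hω : IsWeight ω) (s : S) : 0 ≤ wt ω s :=
  Real.iSup_nonneg fun t => (div_pos (hω.1 _) (hω.1 t)).le

lemma IsWeight.wt_le_s8 (hω : IsWeight ω) (s : S) : wt ω s ≤ ω s :=
  Real.iSup_le (hω.div_le_s8 s) (hω.1 s).le

lemma IsWeight.mul_le_wt_mul (hω : IsWeight ω) (s t : S) : ω (s * t) ≤ wt ω s * ω t :=
  (div_le_iff₀ (hω.1 t)).1 <|
    le_ciSup (f := fun t => ω (s * t) / ω t) ⟨ω s, Set.forall_mem_range.2 (hω.div_le_s8 s)⟩ t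

lemma IsWeight.summable_wt (hω : IsWeight ω) {f : S → ℂ}
    (hf : Summable fun s => ‖f s‖ * ω s) : Summable fun s => ‖f s‖ * wt ω s :=
  hf.of_nonneg_of_le (fun s => mul_nonneg (norm_nonneg _) (hω.wt_nonneg s))
    fun s => mul_le_mul_of_nonneg_left (hω.wt_le_s8 s) (norm_nonneg _)

/-- The convolution of two elements of `ℓ¹(S, ω)` lies in `ℓ¹(S, ω)`, and its norm is controlled
by the `wt ω`-norm of the left factor. -/
lemma IsWeight.conv_bound (hω : IsWeight ω) {f g : S → ℂ}
    (hf : Summable fun s => ‖f s‖ * ω s) (hg : Summable fun s => ‖g s‖ * ω s) :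
    (Summable fun s => ‖conv f g s‖ * ω s) ∧
      wnorm ω (conv f g) ≤ wnorm (wt ω) f * wnorm ω g := by
  classical
  have hf' := hω.summable_wt hf
  have hfg : Summable fun p : S × S => (‖f p.1‖ * wt ω p.1) * (‖g p.2‖ * ω p.2) :=
    hf'.mul_of_nonneg hg
      (fun s => mul_nonneg (norm_nonneg _) (hω.wt_nonneg s))
      (fun s => mul_nonneg (norm_nonneg _) (hω.1 s).le)
  set F : S × S → ℝ := fun p => ‖f p.1‖ * ‖g p.2‖ * ω (p.1 * p.2) with hF
  have hF0 : ∀ p, 0 ≤ F p := fun p =>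
    mul_nonneg (mul_nonneg (norm_nonneg _) (norm_nonneg _)) (hω.1 _).le
  have hFle : ∀ p, F p ≤ (‖f p.1‖ * wt ω p.1) * (‖g p.2‖ * ω p.2) := fun p => by
    have := mul_le_mul_of_nonneg_left (hω.mul_le_wt_mul p.1 p.2)
      (mul_nonneg (norm_nonneg (f p.1)) (norm_nonneg (g p.2)))
    calc F p ≤ _ := this
      _ = _ := by ring
  have hFs : Summable F := hfg.of_nonneg_of_le hF0 hFle
  set H : (S × S) × S → ℝ := fun q => if q.1.1 * q.1.2 = q.2 then F q.1 else 0 with hH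
  have hH0 : ∀ q, 0 ≤ H q := fun q => by
    simp only [hH]; split_ifs; exacts [hF0 _, le_rfl]
  have hfib : ∀ p : S × S, HasSum (fun s => H (p, s)) (F p) := fun p => by
    have := hasSum_ite_eq (p.1 * p.2) (F p)
    simpa only [hH, eq_comm] using this
  have hHs : Summable H := by
    refine (summable_prod_of_nonneg hH0).2 ⟨fun p => (hfib p).summable, ?_⟩
    simpa only [(hfib _).tsum_eq] using hFs
  have hHs' : Summable fun q : S × (S × S) => H (q.2, q.1) := hHs.prod_symm
  have hcol : ∀ s, Summable fun p => H (p, s) := fun s => hHs'.prod_factor s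
  have hpt : ∀ s, ‖conv f g s‖ * ω s ≤ ∑' p, H (p, s) := fun s => by
    have hterm : ∀ p : S × S,
        ‖if p.1 * p.2 = s then f p.1 * g p.2 else 0‖ = H (p, s) / ω s := fun p => by
      simp only [hH, hF]
      split_ifs with h
      · rw [h, norm_mul, mul_div_cancel_right₀ _ (hω.1 s).ne']
      · simp
    rw [← le_div_iff₀ (hω.1 s), ← tsum_div_const]
    unfold conv
    refine (norm_tsum_le_tsum_norm ?_).trans (le_of_eq (tsum_congr fun p => ?_))
    · refine ((hcol s).div_const (ω s)).congr fun p => ?_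
      convert (hterm p).symm using 2
    · convert hterm p using 2
  have hsum : Summable fun s => ‖conv f g s‖ * ω s :=
    hHs'.prod.of_nonneg_of_le (fun s => mul_nonneg (norm_nonneg _) (hω.1 s).le) hpt
  refine ⟨hsum, ?_⟩
  calc wnorm ω (conv f g) ≤ ∑' s, ∑' p, H (p, s) := hsum.tsum_le_tsum hpt hHs'.prod
    _ = ∑' p, ∑' s, H (p, s) := (Summable.tsum_comm (f := fun p s => H (p, s)) hHs)
    _ = ∑' p, F p := tsum_congr fun p => (hfib p).tsum_eq
    _ ≤ ∑' p : S × S, (‖f p.1‖ * wt ω p.1) * (‖g p.2‖ * ω p.2) := hFs.tsum_le_tsum hFle hfg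
    _ = wnorm (wt ω) f * wnorm ω g := (hf'.tsum_mul_tsum hg hfg).symm

lemma RightCancellative.conv_single [DecidableEq S] (hS : RightCancellative S) (f : S → ℂ)
    (s t : S) (c : ℂ) : conv f (Pi.single s c) (t * s) = f t * c := by
  unfold conv
  rw [tsum_eq_single (t, s)]
  · simp
  · rintro ⟨u, v⟩ huv
    by_cases hv : v = s
    · subst hv
      exact if_neg fun h => huv (by rw [hS u t v h])
    · simp [Pi.single_eq_of_ne hv]

end Weight

lemma hasSum_norm_single_mul {S : Type*} [DecidableEq S] (ω : S → ℝ) (s : S) (c : ℂ) :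
    HasSum (fun x => ‖(Pi.single s c : S → ℂ) x‖ * ω x) (‖c‖ * ω s) := by
  convert hasSum_single s fun x hx => ?_ using 1
  · simp
  · simp [Pi.single_eq_of_ne hx]

theorem stmt8 {S : Type*} [Semigroup S] (hS : RightCancellative S)
    (ω : S → ℝ) (hω : IsWeight ω) (hF : FProp ω) :
    ∀ f : S → ℂ, (Summable fun s => ‖f s‖ * ω s) →
      opW ω f = wnorm (wt ω) f := by
  classical
  intro f hf
  have hN : 0 ≤ wnorm (wt ω) f :=
    tsum_nonneg fun s => mul_nonneg (norm_nonneg _) (hω.wt_nonneg s)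
  have hub : ∀ x ∈ {r : ℝ | ∃ g : S → ℂ, (Summable fun s => ‖g s‖ * ω s) ∧ wnorm ω g ≤ 1 ∧
      r = wnorm ω (conv f g)}, x ≤ wnorm (wt ω) f := by
    rintro _ ⟨g, hg, hg1, rfl⟩
    exact (hω.conv_bound hf hg).2.trans (mul_le_of_le_one_right hN hg1)
  refine le_antisymm (Real.sSup_le hub hN) ?_
  refine (hω.summable_wt hf).tsum_le_of_sum_le fun T => ?_
  have hlim : Filter.Tendsto (fun r : ℝ => r * ∑ t ∈ T, ‖f t‖ * wt ω t) (nhdsWithin 1 (Set.Iio 1))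
      (nhds (∑ t ∈ T, ‖f t‖ * wt ω t)) := by
    have := ((continuous_id.mul continuous_const).tendsto'
      (1 : ℝ) _ (one_mul (∑ t ∈ T, ‖f t‖ * wt ω t)))
    exact this.mono_left nhdsWithin_le_nhds
  refine le_of_tendsto hlim ?_
  filter_upwards [Ioo_mem_nhdsLT one_pos] with r ⟨hr0, hr1⟩
  obtain ⟨s, hs⟩ := hF T r hr0 hr1
  have hsp := hω.1 s
  have hg := hasSum_norm_single_mul ω s ((ω s : ℂ)⁻¹)
  have hc : ‖((ω s : ℂ)⁻¹)‖ = (ω s)⁻¹ := by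
    rw [norm_inv, Complex.norm_real, Real.norm_of_nonneg hsp.le]
  have hg1 : wnorm ω (Pi.single s ((ω s : ℂ)⁻¹)) ≤ 1 := by
    rw [wnorm, hg.tsum_eq, hc, inv_mul_cancel₀ hsp.ne']
  have hinj : Function.Injective fun t => t * s := fun x y h => hS x y s h
  calc r * ∑ t ∈ T, ‖f t‖ * wt ω t
      ≤ ∑ t ∈ T, ‖f t‖ * (ω (t * s) / ω s) := by
        rw [Finset.mul_sum]
        refine Finset.sum_le_sum fun t ht => ?_
        rw [mul_left_comm]
        exact mul_le_mul_of_nonneg_left (hs t ht) (norm_nonneg _)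
    _ = ∑ x ∈ T.map ⟨_, hinj⟩, ‖conv f (Pi.single s ((ω s : ℂ)⁻¹)) x‖ * ω x := by
        rw [Finset.sum_map]
        refine Finset.sum_congr rfl fun t _ => ?_
        simp only [Function.Embedding.coeFn_mk, hS.conv_single, norm_mul, hc]
        ring
    _ ≤ wnorm ω (conv f (Pi.single s ((ω s : ℂ)⁻¹))) :=
        (hω.conv_bound hf hg.summable).1.sum_le_tsum _
          fun x _ => mul_nonneg (norm_nonneg _) (hω.1 x).le
    _ ≤ opW ω f := le_csSup ⟨_, hub⟩ ⟨_, hg.summable, hg1, rfl⟩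
end

section
/- Let S be a right cancellative semigroup and ω a weight on S satisfying the F-property, and suppose ω̃₁(s) = ω(s) for all s ∈ S. Then the norm ‖·‖_ω on ℓ¹(S, ω) is regular: ‖f‖_{ω op} = ‖f‖_ω for every f ∈ ℓ¹(S, ω). -/
open scoped ENNReal

/-- The weighted norm with values in the extended nonnegative reals. -/
noncomputable def ewnorm {S : Type*} (ω : S → ℝ) (f : S → ℂ) : ℝ≥0∞ :=
  ∑' s, ‖f s‖ₑ * ENNReal.ofReal (ω s)

lemma wnorm_eq_toReal_ewnorm {S : Type*} {ω : S → ℝ} (hω : ∀ s, 0 < ω s) (f : S → ℂ) :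
    wnorm ω f = (ewnorm ω f).toReal := by
  rw [ewnorm, ENNReal.tsum_toReal_eq fun s => ENNReal.mul_ne_top enorm_ne_top ENNReal.ofReal_ne_top]
  simp [wnorm, ENNReal.toReal_ofReal (hω _).le]

lemma summable_iff_ewnorm_ne_top {S : Type*} {ω : S → ℝ} (hω : ∀ s, 0 < ω s) (f : S → ℂ) :
    (Summable fun s => ‖f s‖ * ω s) ↔ ewnorm ω f ≠ ⊤ := by
  have h (s : S) : ‖f s‖ₑ * ENNReal.ofReal (ω s) = ENNReal.ofReal (‖f s‖ * ω s) := by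
    rw [ENNReal.ofReal_mul (norm_nonneg _), ofReal_norm]
  simp only [ewnorm, h]
  refine ⟨fun hf => hf.tsum_ofReal_ne_top, fun hf => ?_⟩
  have := ENNReal.summable_toReal hf
  simpa [ENNReal.toReal_ofReal, mul_nonneg, (hω _).le] using this

lemma ewnorm_conv_le {S : Type*} [Semigroup S] {ω : S → ℝ} (hω : IsWeight ω) (f g : S → ℂ) :
    ewnorm ω (conv f g) ≤ ewnorm ω f * ewnorm ω g := by
  classical
  calc ewnorm ω (conv f g)
      ≤ ∑' s, ∑' p : S × S, if s = p.1 * p.2 then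
          ‖f p.1‖ₑ * ‖g p.2‖ₑ * ENNReal.ofReal (ω (p.1 * p.2)) else 0 := by
        refine ENNReal.tsum_le_tsum fun s => ?_
        calc ‖conv f g s‖ₑ * ENNReal.ofReal (ω s)
            ≤ (∑' p : S × S, ‖if p.1 * p.2 = s then f p.1 * g p.2 else 0‖ₑ) *
                ENNReal.ofReal (ω s) := by
              gcongr
              exact enorm_tsum_le_tsum_enorm
          _ = _ := by
              rw [← ENNReal.tsum_mul_right]
              refine tsum_congr fun p => ?_
              by_cases h : p.1 * p.2 = s
              · simp [h, enorm_mul]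
              · simp [h, Ne.symm h]
    _ = ∑' p : S × S, ‖f p.1‖ₑ * ‖g p.2‖ₑ * ENNReal.ofReal (ω (p.1 * p.2)) := by
        rw [ENNReal.tsum_comm]
        exact tsum_congr fun p => tsum_ite_eq _ _
    _ ≤ ∑' p : S × S, (‖f p.1‖ₑ * ENNReal.ofReal (ω p.1)) *
          (‖g p.2‖ₑ * ENNReal.ofReal (ω p.2)) := by
        refine ENNReal.tsum_le_tsum fun p => ?_
        rw [mul_mul_mul_comm, ← ENNReal.ofReal_mul (hω.1 _).le]
        gcongr
        exact hω.2 _ _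
    _ = ewnorm ω f * ewnorm ω g := by
        rw [ENNReal.tsum_prod']
        simp only [ENNReal.tsum_mul_left, ENNReal.tsum_mul_right, ewnorm]

lemma summable_conv {S : Type*} [Semigroup S] {ω : S → ℝ} (hω : IsWeight ω) {f g : S → ℂ}
    (hf : Summable fun s => ‖f s‖ * ω s) (hg : Summable fun s => ‖g s‖ * ω s) :
    Summable fun s => ‖conv f g s‖ * ω s := by
  rw [summable_iff_ewnorm_ne_top hω.1] at *
  exact ne_top_of_le_ne_top (ENNReal.mul_ne_top hf hg) (ewnorm_conv_le hω f g)

lemma wnorm_conv_le {S : Type*} [Semigroup S] {ω : S → ℝ} (hω : IsWeight ω) {f g : S → ℂ}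
    (hf : Summable fun s => ‖f s‖ * ω s) (hg : Summable fun s => ‖g s‖ * ω s) :
    wnorm ω (conv f g) ≤ wnorm ω f * wnorm ω g := by
  rw [summable_iff_ewnorm_ne_top hω.1] at hf hg
  simp only [wnorm_eq_toReal_ewnorm hω.1, ← ENNReal.toReal_mul]
  exact ENNReal.toReal_mono (ENNReal.mul_ne_top hf hg) (ewnorm_conv_le hω f g)

open scoped Classical in
lemma conv_single_apply_mul {S : Type*} [Semigroup S] (hS : RightCancellative S)
    (f : S → ℂ) (s : S) (c : ℂ) (u : S) :
    conv f (Pi.single s c) (u * s) = f u * c := by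
  rw [conv, tsum_eq_single (u, s)]
  · simp
  · rintro ⟨v, t⟩ hne
    by_cases ht : t = s
    · subst ht
      exact if_neg fun h => hne (Prod.ext (hS _ _ _ h) rfl)
    · simp [ht]

lemma wnorm_nonneg {S : Type*} {ω : S → ℝ} (hω : ∀ s, 0 < ω s) (f : S → ℂ) : 0 ≤ wnorm ω f :=
  tsum_nonneg fun s => mul_nonneg (norm_nonneg _) (hω s).le

theorem stmt10 {S : Type*} [Semigroup S] (hS : RightCancellative S)
    (ω : S → ℝ) (hω : IsWeight ω) (hF : FProp ω)
    (heq : ∀ s : S, wt ω s = ω s) :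
    ∀ f : S → ℂ, (Summable fun s => ‖f s‖ * ω s) →
      opW ω f = wnorm ω f := by
  classical
  intro f hf
  have hub : ∀ r ∈ {r : ℝ | ∃ g : S → ℂ, (Summable fun s => ‖g s‖ * ω s) ∧ wnorm ω g ≤ 1 ∧
      r = wnorm ω (conv f g)}, r ≤ wnorm ω f := by
    rintro _ ⟨g, hg, hg1, rfl⟩
    exact (wnorm_conv_le hω hf hg).trans (mul_le_of_le_one_right (wnorm_nonneg hω.1 f) hg1)
  refine le_antisymm (Real.sSup_le hub (wnorm_nonneg hω.1 f)) ?_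
  refine hf.tsum_le_of_sum_le fun T => ?_
  have hsum_nonneg : 0 ≤ ∑ u ∈ T, ‖f u‖ * ω u :=
    Finset.sum_nonneg fun u _ => mul_nonneg (norm_nonneg _) (hω.1 u).le
  refine le_of_forall_lt_imp_le_of_dense fun a ha => ?_
  obtain ⟨r, hr0, hr1, har⟩ : ∃ r : ℝ, 0 < r ∧ r < 1 ∧ a ≤ r * ∑ u ∈ T, ‖f u‖ * ω u := by
    rcases hsum_nonneg.eq_or_lt with h | h
    · exact ⟨1 / 2, by norm_num, by norm_num, by rw [← h] at ha ⊢; linarith⟩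
    · obtain ⟨r, hr, hr1⟩ := exists_between (max_lt ((div_lt_one h).2 ha) zero_lt_one)
      exact ⟨r, (le_max_right _ _).trans_lt hr, hr1,
        (div_le_iff₀ h).1 ((le_max_left _ _).trans hr.le)⟩
  obtain ⟨s, hs⟩ := hF T r hr0 hr1
  have hωs := hω.1 s
  have hg (t : S) : ‖(Pi.single s ((ω s)⁻¹ : ℂ) : S → ℂ) t‖ * ω t = if t = s then 1 else 0 := by
    by_cases h : t = s
    · subst h
      simp [abs_of_pos hωs, hωs.ne']
    · simp [h]
  have hgs : Summable fun t => ‖(Pi.single s ((ω s)⁻¹ : ℂ) : S → ℂ) t‖ * ω t := by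
    simp only [hg]
    exact (hasSum_ite_eq s (1 : ℝ)).summable
  calc a ≤ r * ∑ u ∈ T, ‖f u‖ * ω u := har
    _ ≤ ∑ u ∈ T, ‖conv f (Pi.single s ((ω s)⁻¹ : ℂ)) (u * s)‖ * ω (u * s) := by
        rw [Finset.mul_sum]
        refine Finset.sum_le_sum fun u hu => ?_
        rw [conv_single_apply_mul hS, norm_mul, norm_inv, Complex.norm_real, Real.norm_eq_abs,
          abs_of_pos hωs, mul_assoc, ← div_eq_inv_mul, mul_left_comm, ← heq u]
        exact mul_le_mul_of_nonneg_left (hs u hu) (norm_nonneg _)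
    _ = ∑ t ∈ T.image (· * s), ‖conv f (Pi.single s ((ω s)⁻¹ : ℂ)) t‖ * ω t :=
        (Finset.sum_image (f := fun t => ‖conv f (Pi.single s ((ω s)⁻¹ : ℂ)) t‖ * ω t)
          fun x _ y _ h => hS x y s h).symm
    _ ≤ wnorm ω (conv f (Pi.single s ((ω s)⁻¹ : ℂ))) :=
        (summable_conv hω hf hgs).sum_le_tsum _
          fun t _ => mul_nonneg (norm_nonneg _) (hω.1 t).le
    _ ≤ opW ω f := le_csSup ⟨_, hub⟩ ⟨_, hgs, by simp [wnorm, hg], rfl⟩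
end

section
/- Let X be a nonempty set, ω : X → [1, ∞) any function, and 1 ≤ p < ∞. For f ∈ ℓ_p(X, ω), the operator norm of f with respect to the pointwise product equals the supremum norm: sup{ ‖f·g‖_{pω} : g ∈ ℓ_p(X, ω), ‖g‖_{pω} ≤ 1 } = ‖f‖_∞ = sup_{x∈X} |f(x)|. -/
/-- The weighted `p`-norm `‖f‖_{pω} = (Σ_x (|f(x)| ω(x))^p)^{1/p}`. -/
noncomputable def pnorm {X : Type*} (ω : X → ℝ) (p : ℝ) (f : X → ℂ) : ℝ :=
  (∑' x, (‖f x‖ * ω x) ^ p) ^ (1 / p)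

/-- The operator norm of `f` on `ℓ_p(X, ω)` with the pointwise product. -/
noncomputable def opP {X : Type*} (ω : X → ℝ) (p : ℝ) (f : X → ℂ) : ℝ :=
  sSup {r : ℝ | ∃ g : X → ℂ, (Summable fun x => (‖g x‖ * ω x) ^ p) ∧
    pnorm ω p g ≤ 1 ∧ r = pnorm ω p fun x => f x * g x}

theorem pnorm_single {X : Type*} {ω : X → ℝ} {p : ℝ} (hp : 0 < p) {f : X → ℂ} {x : X}
    (hx : 0 ≤ ω x) (hf : ∀ y, y ≠ x → f y = 0) : pnorm ω p f = ‖f x‖ * ω x := by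
  have h : ∀ y, y ≠ x → (‖f y‖ * ω y) ^ p = 0 := fun y hy => by
    simp [hf y hy, Real.zero_rpow hp.ne']
  rw [pnorm, tsum_eq_single x h, ← Real.rpow_mul (by positivity), mul_one_div_cancel hp.ne',
    Real.rpow_one]

theorem norm_le_pnorm {X : Type*} {ω : X → ℝ} (hω : ∀ x, 1 ≤ ω x) {p : ℝ} (hp : 0 < p)
    {f : X → ℂ} (hf : Summable fun x => (‖f x‖ * ω x) ^ p) (x : X) : ‖f x‖ ≤ pnorm ω p f := by
  have h0 : ∀ y, 0 ≤ ‖f y‖ * ω y := fun y =>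
    mul_nonneg (norm_nonneg _) (zero_le_one.trans (hω y))
  calc ‖f x‖ ≤ ‖f x‖ * ω x := le_mul_of_one_le_right (norm_nonneg _) (hω x)
    _ = ((‖f x‖ * ω x) ^ p) ^ (1 / p) := by
      rw [← Real.rpow_mul (h0 x), mul_one_div_cancel hp.ne', Real.rpow_one]
    _ ≤ pnorm ω p f := by
      refine Real.rpow_le_rpow (Real.rpow_nonneg (h0 x) _) ?_ (by positivity)
      exact hf.le_tsum x fun y _ => Real.rpow_nonneg (h0 y) _

theorem pnorm_mul_le {X : Type*} {ω : X → ℝ} (hω : ∀ x, 0 ≤ ω x) {p : ℝ} (hp : 0 < p)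
    {f g : X → ℂ} (hg : Summable fun x => (‖g x‖ * ω x) ^ p) {S : ℝ} (hS : 0 ≤ S)
    (hf : ∀ x, ‖f x‖ ≤ S) : pnorm ω p (fun x => f x * g x) ≤ S * pnorm ω p g := by
  have hg0 : ∀ x, 0 ≤ ‖g x‖ * ω x := fun x => mul_nonneg (norm_nonneg _) (hω x)
  have h0 : ∀ x, 0 ≤ ‖f x * g x‖ * ω x := fun x => mul_nonneg (norm_nonneg _) (hω x)
  have hle : ∀ x, (‖f x * g x‖ * ω x) ^ p ≤ S ^ p * (‖g x‖ * ω x) ^ p := fun x => by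
    rw [← Real.mul_rpow hS (hg0 x)]
    refine Real.rpow_le_rpow (h0 x) ?_ hp.le
    rw [norm_mul, mul_assoc]
    exact mul_le_mul_of_nonneg_right (hf x) (hg0 x)
  have hs : Summable fun x => (‖f x * g x‖ * ω x) ^ p :=
    Summable.of_nonneg_of_le (fun x => Real.rpow_nonneg (h0 x) _) hle (hg.mul_left _)
  have ht : ∑' x, (‖f x * g x‖ * ω x) ^ p ≤ S ^ p * ∑' x, (‖g x‖ * ω x) ^ p := by
    rw [← tsum_mul_left]
    exact hs.tsum_le_tsum hle (hg.mul_left _)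
  calc pnorm ω p (fun x => f x * g x)
      ≤ (S ^ p * ∑' x, (‖g x‖ * ω x) ^ p) ^ (1 / p) :=
        Real.rpow_le_rpow (tsum_nonneg fun x => Real.rpow_nonneg (h0 x) _) ht (by positivity)
    _ = S * pnorm ω p g := by
      rw [Real.mul_rpow (Real.rpow_nonneg hS _)
        (tsum_nonneg fun x => Real.rpow_nonneg (hg0 x) _), ← Real.rpow_mul hS,
        mul_one_div_cancel hp.ne', Real.rpow_one, pnorm]

theorem stmt15 {X : Type*} [Nonempty X] (ω : X → ℝ) (hω : ∀ x, 1 ≤ ω x)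
    (p : ℝ) (hp : 1 ≤ p) (f : X → ℂ)
    (hf : Summable fun x => (‖f x‖ * ω x) ^ p) :
    opP ω p f = ⨆ x, ‖f x‖ := by
  classical
  have hp0 : 0 < p := zero_lt_one.trans_le hp
  have hω0 : ∀ x, 0 < ω x := fun x => zero_lt_one.trans_le (hω x)
  have hbdd : BddAbove (Set.range fun x => ‖f x‖) :=
    ⟨pnorm ω p f, Set.forall_mem_range.2 (norm_le_pnorm hω hp0 hf)⟩
  have hS : 0 ≤ ⨆ x, ‖f x‖ := Real.iSup_nonneg fun x => norm_nonneg _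
  have hub : ∀ r ∈ {r : ℝ | ∃ g : X → ℂ, (Summable fun x => (‖g x‖ * ω x) ^ p) ∧
      pnorm ω p g ≤ 1 ∧ r = pnorm ω p fun x => f x * g x}, r ≤ ⨆ x, ‖f x‖ := by
    rintro r ⟨g, hg, hg1, rfl⟩
    exact (pnorm_mul_le (fun x => (hω0 x).le) hp0 hg hS (le_ciSup hbdd)).trans
      (mul_le_of_le_one_right hS hg1)
  refine le_antisymm (Real.sSup_le hub hS) (ciSup_le fun x => le_csSup ⟨_, hub⟩ ?_)
  have hg : ∀ y, y ≠ x → (Pi.single x ((ω x : ℂ)⁻¹) : X → ℂ) y = 0 := fun y hy =>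
    Pi.single_eq_of_ne hy _
  refine ⟨Pi.single x ((ω x : ℂ)⁻¹), ?_, ?_, ?_⟩
  · refine summable_of_ne_finset_zero (s := {x}) fun y hy => ?_
    rw [hg y (by simpa using hy), norm_zero, zero_mul, Real.zero_rpow hp0.ne']
  · rw [pnorm_single hp0 (hω0 x).le hg]
    simp [abs_of_pos (hω0 x), (hω0 x).ne']
  · rw [pnorm_single hp0 (hω0 x).le fun y hy => by rw [hg y hy, mul_zero]]
    simp [abs_of_pos (hω0 x), (hω0 x).ne']
end

section
/- Let X be an infinite set, ω : X → [1, ∞) any function, and 1 ≤ p < ∞. Then the norm ‖·‖_{pω} on ℓ_p(X, ω) with pointwise product is not regular: for every n ∈ ℕ there exists f ∈ ℓ_p(X, ω) with sup{ ‖f·g‖_{pω} : ‖g‖_{pω} ≤ 1 } = 1 but ‖f‖_{pω} ≥ n. In particular there exists f ∈ ℓ_p(X, ω) with sup{ ‖f·g‖_{pω} : ‖g‖_{pω} ≤ 1 } < ‖f‖_{pω}. -/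
lemma rpow_weighted_nonneg {X : Type*} {ω : X → ℝ} (hω : ∀ x, 1 ≤ ω x) (p : ℝ) (f : X → ℂ)
    (x : X) : 0 ≤ (‖f x‖ * ω x) ^ p :=
  Real.rpow_nonneg (mul_nonneg (norm_nonneg _) (zero_le_one.trans (hω x))) p

lemma pnorm_mul_le_of_norm_le_one {X : Type*} {ω : X → ℝ} (hω : ∀ x, 1 ≤ ω x) {p : ℝ}
    (hp : 0 ≤ p) {f g : X → ℂ} (hf : ∀ x, ‖f x‖ ≤ 1)
    (hg : Summable fun x => (‖g x‖ * ω x) ^ p) :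
    pnorm ω p (fun x => f x * g x) ≤ pnorm ω p g := by
  have hle : ∀ x, (‖f x * g x‖ * ω x) ^ p ≤ (‖g x‖ * ω x) ^ p := fun x => by
    have hωx : 0 ≤ ω x := zero_le_one.trans (hω x)
    refine Real.rpow_le_rpow (by positivity) ?_ hp
    rw [norm_mul]
    exact mul_le_mul_of_nonneg_right (mul_le_of_le_one_left (norm_nonneg _) (hf x)) hωx
  have hnonneg := rpow_weighted_nonneg hω p fun x => f x * g x
  exact Real.rpow_le_rpow (tsum_nonneg hnonneg)
    ((Summable.of_nonneg_of_le hnonneg hle hg).tsum_le_tsum hle hg) (by positivity)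

open Classical in
lemma hasSum_rpow_weighted_single {X : Type*} {ω : X → ℝ} (hω : ∀ x, 1 ≤ ω x) {p : ℝ}
    (hp : 0 < p) (a : X) :
    HasSum (fun x => (‖(Pi.single a ((ω a : ℂ)⁻¹) : X → ℂ) x‖ * ω x) ^ p) 1 := by
  have ha : 0 < ω a := zero_lt_one.trans_le (hω a)
  convert hasSum_single (f := fun x => (‖(Pi.single a ((ω a : ℂ)⁻¹) : X → ℂ) x‖ * ω x) ^ p)
    a ?_ using 1
  · simp [abs_of_pos ha, ha.ne']
  · intro x hx
    simp [Pi.single_eq_of_ne hx, hp.ne']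

lemma opP_eq_one {X : Type*} {ω : X → ℝ} (hω : ∀ x, 1 ≤ ω x) {p : ℝ} (hp : 0 < p)
    {f : X → ℂ} (hf : ∀ x, ‖f x‖ ≤ 1) {a : X} (ha : f a = 1) : opP ω p f = 1 := by
  classical
  have hsum := hasSum_rpow_weighted_single hω hp a
  have hnorm : pnorm ω p (Pi.single a ((ω a : ℂ)⁻¹)) = 1 := by
    rw [pnorm, hsum.tsum_eq, Real.one_rpow]
  refine IsGreatest.csSup_eq ⟨⟨Pi.single a ((ω a : ℂ)⁻¹), hsum.summable, hnorm.le, ?_⟩, ?_⟩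
  · rw [← hnorm]
    congr 1
    ext x
    by_cases hx : x = a
    · subst hx; simp [ha]
    · simp [Pi.single_eq_of_ne hx]
  · rintro r ⟨g, hg, hg1, rfl⟩
    exact (pnorm_mul_le_of_norm_le_one hω hp.le hf hg).trans hg1

lemma exists_opP_eq_one_le_pnorm {X : Type*} [Infinite X] {ω : X → ℝ} (hω : ∀ x, 1 ≤ ω x)
    {p : ℝ} (hp : 0 < p) (n : ℕ) :
    ∃ f : X → ℂ, (Summable fun x => (‖f x‖ * ω x) ^ p) ∧
      opP ω p f = 1 ∧ (n : ℝ) ≤ pnorm ω p f := by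
  classical
  obtain ⟨m, hm⟩ := exists_nat_ge ((n : ℝ) ^ p)
  obtain ⟨S, hS⟩ := Infinite.exists_subset_card_eq X (m + 1)
  obtain ⟨a, ha⟩ : S.Nonempty := Finset.card_pos.mp (hS ▸ m.succ_pos)
  obtain ⟨f, hf1, hf0⟩ : ∃ f : X → ℂ, (∀ x ∈ S, f x = 1) ∧ ∀ x ∉ S, f x = 0 :=
    ⟨fun x => if x ∈ S then 1 else 0, fun _ hx => if_pos hx, fun _ hx => if_neg hx⟩
  have hf : ∀ x, ‖f x‖ ≤ 1 := fun x => by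
    by_cases hx : x ∈ S
    · simp [hf1 x hx]
    · simp [hf0 x hx]
  have hsum : Summable fun x => (‖f x‖ * ω x) ^ p :=
    summable_of_ne_finset_zero (s := S) fun x hx => by simp [hf0 x hx, hp.ne']
  refine ⟨f, hsum, opP_eq_one hω hp hf (hf1 a ha), ?_⟩
  have hcard : (n : ℝ) ^ p ≤ ∑' x, (‖f x‖ * ω x) ^ p := calc
    (n : ℝ) ^ p ≤ (S.card : ℝ) := by
      rw [hS]; push_cast; linarith
    _ = ∑ _x ∈ S, (1 : ℝ) := by simp
    _ ≤ ∑ x ∈ S, (‖f x‖ * ω x) ^ p :=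
      Finset.sum_le_sum fun x hx => by
        simpa [hf1 x hx] using Real.one_le_rpow (hω x) hp.le
    _ ≤ ∑' x, (‖f x‖ * ω x) ^ p :=
      hsum.sum_le_tsum S fun x _ => rpow_weighted_nonneg hω p f x
  have hroot : ((n : ℝ) ^ p) ^ (1 / p) = n := by
    rw [one_div, Real.rpow_rpow_inv n.cast_nonneg hp.ne']
  rw [pnorm, ← hroot]
  exact Real.rpow_le_rpow (by positivity) hcard (by positivity)

theorem stmt16 {X : Type*} [Infinite X] (ω : X → ℝ) (hω : ∀ x, 1 ≤ ω x)
    (p : ℝ) (hp : 1 ≤ p) :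
    (∀ n : ℕ, ∃ f : X → ℂ, (Summable fun x => (‖f x‖ * ω x) ^ p) ∧
      opP ω p f = 1 ∧ (n : ℝ) ≤ pnorm ω p f) ∧
    ∃ f : X → ℂ, (Summable fun x => (‖f x‖ * ω x) ^ p) ∧
      opP ω p f < pnorm ω p f := by
  have hp0 : 0 < p := zero_lt_one.trans_le hp
  refine ⟨exists_opP_eq_one_le_pnorm hω hp0, ?_⟩
  obtain ⟨f, hf, hop, hn⟩ := exists_opP_eq_one_le_pnorm hω hp0 2
  refine ⟨f, hf, ?_⟩
  rw [hop]
  exact lt_of_lt_of_le (by norm_num) hn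
end

section
/- Let ω be the weight on the additive semigroup ℕ = {1, 2, 3, …} given by ω(n) = e^{-n²}. Then ω̃₁(n) = e^{-n² - 2n} for every n ∈ ℕ; in particular ω̃₁(n) < ω(n) for all n, so the norm ‖·‖_ω on ℓ¹(ℕ, ω) is not regular. -/
/-- The weight `ω(n) = e^{-n²}` on the additive semigroup `ℕ = {1, 2, 3, …}`. -/
noncomputable def ω18 : ℕ+ → ℝ := fun n => Real.exp (-(n : ℝ) ^ 2)

/-- `ω̃₁(n) = sup_{m} ω(n+m)/ω(m)` on the additive semigroup `ℕ⁺`. -/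
noncomputable def wtA (ω : ℕ+ → ℝ) (n : ℕ+) : ℝ :=
  ⨆ m : ℕ+, ω (n + m) / ω m

open scoped Classical in
/-- Convolution on `ℓ¹(ℕ⁺)`: `(f * g)(n) = Σ_{j+k=n} f(j) g(k)`. -/
noncomputable def convA (f g : ℕ+ → ℂ) (n : ℕ+) : ℂ :=
  ∑' p : ℕ+ × ℕ+, if p.1 + p.2 = n then f p.1 * g p.2 else 0

/-- The weighted norm `‖f‖_ω = Σ_n |f(n)| ω(n)`. -/
noncomputable def wnormA (ω : ℕ+ → ℝ) (f : ℕ+ → ℂ) : ℝ :=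
  ∑' n, ‖f n‖ * ω n

/-- The operator norm on `ℓ¹(ℕ⁺, ω)`. -/
noncomputable def opA (ω : ℕ+ → ℝ) (f : ℕ+ → ℂ) : ℝ :=
  sSup {r : ℝ | ∃ g : ℕ+ → ℂ,
    (Summable fun n => ‖g n‖ * ω n) ∧ wnormA ω g ≤ 1 ∧ r = wnormA ω (convA f g)}

/-- Convolving with the point mass at `n` translates by `n`. -/
lemma convA_single_add (g : ℕ+ → ℂ) (n m : ℕ+) :
    convA (Pi.single n 1) g (n + m) = g m := by
  unfold convA
  rw [tsum_eq_single (n, m)]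
  · simp
  · rintro ⟨a, b⟩ hab
    split_ifs with h
    · by_cases ha : a = n
      · subst ha
        exact absurd (by simpa using h) (by simpa using hab)
      · simp [Pi.single_eq_of_ne ha]
    · rfl

lemma convA_single_of_notMem_range (g : ℕ+ → ℂ) {n k : ℕ+}
    (hk : k ∉ Set.range (n + ·)) : convA (Pi.single n 1) g k = 0 := by
  unfold convA
  refine (tsum_congr fun p => ?_).trans tsum_zero
  split_ifs with h
  · have ha : p.1 ≠ n := by
      rintro rfl
      exact hk ⟨p.2, h⟩
    simp [Pi.single_eq_of_ne ha]
  · rfl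

lemma wnormA_convA_single (ω : ℕ+ → ℝ) (g : ℕ+ → ℂ) (n : ℕ+) :
    wnormA ω (convA (Pi.single n 1) g) = ∑' m, ‖g m‖ * ω (n + m) := by
  unfold wnormA
  rw [← (add_right_injective n).tsum_eq]
  · simp only [convA_single_add]
  · intro k hk
    by_contra h
    exact hk (by simp [convA_single_of_notMem_range g h])

lemma hasSum_norm_single (ω : ℕ+ → ℝ) (n : ℕ+) :
    HasSum (fun k => ‖(Pi.single n 1 : ℕ+ → ℂ) k‖ * ω k) (ω n) := by
  have h := hasSum_single (f := fun k => ‖(Pi.single n 1 : ℕ+ → ℂ) k‖ * ω k) n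
    fun k hk => by simp [Pi.single_eq_of_ne hk]
  simpa using h

lemma opA_single_le_wtA {ω : ℕ+ → ℝ} (hω : ∀ n, 0 < ω n) {n : ℕ+}
    (hb : BddAbove (Set.range fun m => ω (n + m) / ω m)) :
    opA ω (Pi.single n 1) ≤ wtA ω n := by
  have hle : ∀ m, ω (n + m) ≤ wtA ω n * ω m := fun m =>
    (div_le_iff₀ (hω m)).1 (le_ciSup hb m)
  have h0 : 0 ≤ wtA ω n := Real.iSup_nonneg fun m => (div_pos (hω _) (hω _)).le
  refine Real.sSup_le ?_ h0
  rintro _ ⟨g, hg, hg1, rfl⟩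
  have hterm : ∀ m, ‖g m‖ * ω (n + m) ≤ wtA ω n * (‖g m‖ * ω m) := fun m => by
    rw [mul_left_comm]
    exact mul_le_mul_of_nonneg_left (hle m) (norm_nonneg _)
  have hs := hg.mul_left (wtA ω n)
  have hs' : Summable fun m => ‖g m‖ * ω (n + m) :=
    hs.of_nonneg_of_le (fun m => mul_nonneg (norm_nonneg _) (hω _).le) hterm
  calc wnormA ω (convA (Pi.single n 1) g) = ∑' m, ‖g m‖ * ω (n + m) :=
        wnormA_convA_single ω g n
    _ ≤ ∑' m, wtA ω n * (‖g m‖ * ω m) := hs'.tsum_le_tsum hterm hs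
    _ = wtA ω n * wnormA ω g := tsum_mul_left
    _ ≤ wtA ω n := mul_le_of_le_one_right h0 hg1

lemma ω18_add_div (n m : ℕ+) :
    ω18 (n + m) / ω18 m = Real.exp (-((n : ℝ) ^ 2 + 2 * (n : ℝ) * (m : ℝ))) := by
  unfold ω18
  rw [← Real.exp_sub]
  push_cast
  ring_nf

lemma ω18_add_div_le (n m : ℕ+) :
    ω18 (n + m) / ω18 m ≤ Real.exp (-((n : ℝ) ^ 2 + 2 * (n : ℝ))) := by
  rw [ω18_add_div, Real.exp_le_exp]
  have hn : (0 : ℝ) < n := by exact_mod_cast n.pos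
  have hm : (1 : ℝ) ≤ m := by exact_mod_cast m.pos
  nlinarith

lemma bddAbove_ω18_add_div (n : ℕ+) :
    BddAbove (Set.range fun m => ω18 (n + m) / ω18 m) :=
  ⟨_, by rintro _ ⟨m, rfl⟩; exact ω18_add_div_le n m⟩

lemma wtA_ω18 (n : ℕ+) : wtA ω18 n = Real.exp (-((n : ℝ) ^ 2 + 2 * (n : ℝ))) := by
  refine le_antisymm (ciSup_le (ω18_add_div_le n)) ?_
  refine le_trans (le_of_eq ?_) (le_ciSup (bddAbove_ω18_add_div n) 1)
  simp [ω18_add_div]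

lemma wtA_ω18_lt (n : ℕ+) : wtA ω18 n < ω18 n := by
  have hn : (0 : ℝ) < n := by exact_mod_cast n.pos
  rw [wtA_ω18, ω18, Real.exp_lt_exp]
  linarith

theorem stmt18 :
    (∀ n : ℕ+, wtA ω18 n = Real.exp (-((n : ℝ) ^ 2 + 2 * (n : ℝ)))) ∧
    (∀ n : ℕ+, wtA ω18 n < ω18 n) ∧
    ¬ ∀ f : ℕ+ → ℂ, (Summable fun n => ‖f n‖ * ω18 n) → opA ω18 f = wnormA ω18 f := by
  refine ⟨wtA_ω18, wtA_ω18_lt, fun h => ?_⟩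
  have hsum := hasSum_norm_single ω18 1
  have heq : opA ω18 (Pi.single 1 1) = ω18 1 := (h _ hsum.summable).trans hsum.tsum_eq
  have hle := opA_single_le_wtA (ω := ω18) (fun _ => Real.exp_pos _) (bddAbove_ω18_add_div 1)
  exact absurd (wtA_ω18_lt 1) (not_lt.2 (heq ▸ hle))
end

section
/- Let ℚ₊• be the additive semigroup of strictly positive rational numbers, and define ω : ℚ₊• → ℝ by ω(q) = n where q = m/n in lowest terms (i.e. ω(q) is the denominator of q). Then ω is a weight on ℚ₊•, and ω̃₁(q) = ω(q) for every q ∈ ℚ₊•; consequently the norm ‖·‖_ω on ℓ¹(ℚ₊•, ω) is regular. -/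
/-- The additive semigroup of strictly positive rationals. -/
abbrev Qpos := {q : ℚ // 0 < q}

/-- The weight `ω(m/n) = n` (the denominator in lowest terms). -/
noncomputable def ωQ : Qpos → ℝ := fun q => ((q : ℚ).den : ℝ)

/-- `ω̃₁(q) = sup_{t} ω(q+t)/ω(t)` on `ℚ₊•`. -/
noncomputable def wtQ (ω : Qpos → ℝ) (q : Qpos) : ℝ :=
  ⨆ t : Qpos, ω (q + t) / ω t

open scoped Classical in
/-- Convolution on `ℓ¹(ℚ₊•)`: `(f * g)(q) = Σ_{u+v=q} f(u) g(v)`. -/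
noncomputable def convQ (f g : Qpos → ℂ) (q : Qpos) : ℂ :=
  ∑' p : Qpos × Qpos, if p.1 + p.2 = q then f p.1 * g p.2 else 0

/-- The weighted norm `‖f‖_ω = Σ_q |f(q)| ω(q)`. -/
noncomputable def wnormQ (ω : Qpos → ℝ) (f : Qpos → ℂ) : ℝ :=
  ∑' q, ‖f q‖ * ω q

/-- The operator norm on `ℓ¹(ℚ₊•, ω)`. -/
noncomputable def opQ (ω : Qpos → ℝ) (f : Qpos → ℂ) : ℝ :=
  sSup {r : ℝ | ∃ g : Qpos → ℂ,
    (Summable fun q => ‖g q‖ * ω q) ∧ wnormQ ω g ≤ 1 ∧ r = wnormQ ω (convQ f g)}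

lemma ωQ_pos (q : Qpos) : 0 < ωQ q := Nat.cast_pos.mpr (q : ℚ).den_pos

lemma ωQ_add_le (q t : Qpos) : ωQ (q + t) ≤ ωQ q * ωQ t := by
  have h : ((q : ℚ) + t).den ≤ (q : ℚ).den * (t : ℚ).den :=
    Nat.le_of_dvd (Nat.mul_pos (q : ℚ).den_pos (t : ℚ).den_pos) (Rat.add_den_dvd _ _)
  unfold ωQ
  exact_mod_cast h

/-- The rational number `1` as an element of `Qpos`. -/
def oneQpos : Qpos := ⟨1, one_pos⟩

lemma ωQ_oneQpos : ωQ oneQpos = 1 := by simp [ωQ, oneQpos]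

lemma ωQ_add_oneQpos (q : Qpos) : ωQ (q + oneQpos) = ωQ q := by
  have h : ((q : ℚ) + 1).den = (q : ℚ).den := by
    simp
  simp only [ωQ, oneQpos, Positive.coe_add, h]

lemma wtQ_ωQ (q : Qpos) : wtQ ωQ q = ωQ q := by
  have hle (t : Qpos) : ωQ (q + t) / ωQ t ≤ ωQ q :=
    (div_le_iff₀ (ωQ_pos t)).mpr (ωQ_add_le q t)
  have : Nonempty Qpos := ⟨oneQpos⟩
  refine le_antisymm (ciSup_le hle) ?_
  have h := le_ciSup (f := fun t : Qpos => ωQ (q + t) / ωQ t)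
    ⟨ωQ q, by rintro _ ⟨t, rfl⟩; exact hle t⟩ oneQpos
  simpa [wtQ, ωQ_oneQpos, ωQ_add_oneQpos] using h

open scoped Classical in
/-- Summing a summable family on pairs first over the pairs with a given sum. -/
lemma hasSum_tsum_add_eq {F : Qpos × Qpos → ℝ} (hF : Summable F) :
    Summable (fun x : Qpos × (Qpos × Qpos) => if x.2.1 + x.2.2 = x.1 then F x.2 else 0) ∧
    HasSum (fun q : Qpos => ∑' p : Qpos × Qpos, if p.1 + p.2 = q then F p else 0)
      (∑' p, F p) := by
  have hinj : Function.Injective fun p : Qpos × Qpos => (p.1 + p.2, p) :=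
    fun a b h => (Prod.ext_iff.mp h).2
  have hG : HasSum
      (fun x : Qpos × (Qpos × Qpos) => if x.2.1 + x.2.2 = x.1 then F x.2 else 0)
      (∑' p, F p) := by
    refine (hinj.hasSum_iff ?_).mp ?_
    · rintro ⟨q, p⟩ hx
      refine if_neg fun h => hx ⟨p, ?_⟩
      exact Prod.ext h rfl
    · simpa [Function.comp_def] using hF.hasSum
  exact ⟨hG.summable, hG.prod_fiberwise fun q => (hG.summable.prod_factor q).hasSum⟩

lemma wnormQ_convQ_le {f g : Qpos → ℂ} (hf : Summable fun q => ‖f q‖ * ωQ q)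
    (hg : Summable fun q => ‖g q‖ * ωQ q) :
    wnormQ ωQ (convQ f g) ≤ wnormQ ωQ f * wnormQ ωQ g := by
  classical
  have hnn (f : Qpos → ℂ) (q : Qpos) : 0 ≤ ‖f q‖ * ωQ q :=
    mul_nonneg (norm_nonneg _) (ωQ_pos q).le
  have hF := hf.mul_of_nonneg hg (hnn f) (hnn g)
  obtain ⟨hG, hS⟩ := hasSum_tsum_add_eq hF
  have key (q : Qpos) : ‖convQ f g q‖ * ωQ q ≤ ∑' p : Qpos × Qpos,
      if p.1 + p.2 = q then (‖f p.1‖ * ωQ p.1) * (‖g p.2‖ * ωQ p.2) else 0 := by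
    have hq := hG.prod_factor q
    have hterm (p : Qpos × Qpos) :
        ‖if p.1 + p.2 = q then f p.1 * g p.2 else 0‖ * ωQ q ≤
          if p.1 + p.2 = q then (‖f p.1‖ * ωQ p.1) * (‖g p.2‖ * ωQ p.2) else 0 := by
      split_ifs with h
      · rw [norm_mul, ← h]
        calc ‖f p.1‖ * ‖g p.2‖ * ωQ (p.1 + p.2)
            ≤ ‖f p.1‖ * ‖g p.2‖ * (ωQ p.1 * ωQ p.2) := by
              gcongr
              exact ωQ_add_le _ _
          _ = _ := by ring
      · simp
    have hs : Summable fun p : Qpos × Qpos =>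
        ‖if p.1 + p.2 = q then f p.1 * g p.2 else 0‖ * ωQ q :=
      Summable.of_nonneg_of_le
        (fun p => mul_nonneg (norm_nonneg _) (ωQ_pos q).le) hterm hq
    have hs' := (summable_mul_right_iff (ωQ_pos q).ne').mp hs
    calc ‖convQ f g q‖ * ωQ q
        ≤ (∑' p : Qpos × Qpos, ‖if p.1 + p.2 = q then f p.1 * g p.2 else 0‖) * ωQ q :=
          mul_le_mul_of_nonneg_right (norm_tsum_le_tsum_norm hs') (ωQ_pos q).le
      _ = ∑' p : Qpos × Qpos, ‖if p.1 + p.2 = q then f p.1 * g p.2 else 0‖ * ωQ q :=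
          tsum_mul_right.symm
      _ ≤ _ := hs.tsum_le_tsum hterm hq
  calc wnormQ ωQ (convQ f g)
      ≤ ∑' p : Qpos × Qpos, (‖f p.1‖ * ωQ p.1) * (‖g p.2‖ * ωQ p.2) := by
        rw [← hS.tsum_eq]
        exact (Summable.of_nonneg_of_le (hnn _) key hS.summable).tsum_le_tsum key hS.summable
    _ = wnormQ ωQ f * wnormQ ωQ g := (hf.tsum_mul_tsum hg hF).symm

lemma hasSum_norm_single_oneQpos :
    HasSum (fun q => ‖(Pi.single oneQpos 1 : Qpos → ℂ) q‖ * ωQ q) 1 := by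
  convert hasSum_single oneQpos ?_ using 1
  · simp [ωQ_oneQpos]
  · intro q hq
    simp [Pi.single_eq_of_ne hq]

lemma wnormQ_convQ_single_oneQpos (f : Qpos → ℂ) :
    wnormQ ωQ (convQ f (Pi.single oneQpos 1)) = wnormQ ωQ f := by
  have hinj : Function.Injective fun r : Qpos => r + oneQpos := add_left_injective _
  have hval (r : Qpos) : convQ f (Pi.single oneQpos 1) (r + oneQpos) = f r := by
    unfold convQ
    rw [tsum_eq_single (r, oneQpos)]
    · simp
    · rintro ⟨u, v⟩ h
      by_cases hv : v = oneQpos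
      · subst hv
        refine if_neg fun h' => h ?_
        exact congrArg (·, oneQpos) (hinj h')
      · simp [Pi.single_eq_of_ne hv]
  have hzero (q : Qpos) (hq : q ∉ Set.range fun r : Qpos => r + oneQpos) :
      convQ f (Pi.single oneQpos 1) q = 0 := by
    unfold convQ
    convert tsum_zero with p
    obtain ⟨u, v⟩ := p
    by_cases hv : v = oneQpos
    · subst hv
      exact if_neg fun h => hq ⟨u, h⟩
    · simp [Pi.single_eq_of_ne hv]
  unfold wnormQ
  rw [← hinj.tsum_eq]
  · simp [hval, ωQ_add_oneQpos]
  · intro q hq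
    by_contra h
    exact hq (by simp [hzero q h])

lemma opQ_ωQ {f : Qpos → ℂ} (hf : Summable fun q => ‖f q‖ * ωQ q) :
    opQ ωQ f = wnormQ ωQ f := by
  have hnn : 0 ≤ wnormQ ωQ f :=
    tsum_nonneg fun q => mul_nonneg (norm_nonneg _) (ωQ_pos q).le
  refine IsGreatest.csSup_eq ⟨⟨Pi.single oneQpos 1, hasSum_norm_single_oneQpos.summable,
    hasSum_norm_single_oneQpos.tsum_eq.le, (wnormQ_convQ_single_oneQpos f).symm⟩, ?_⟩
  rintro _ ⟨g, hg, hg1, rfl⟩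
  exact (wnormQ_convQ_le hf hg).trans (mul_le_of_le_one_right hnn hg1)

theorem stmt19 :
    (∀ q : Qpos, 0 < ωQ q) ∧
    (∀ q t : Qpos, ωQ (q + t) ≤ ωQ q * ωQ t) ∧
    (∀ q : Qpos, wtQ ωQ q = ωQ q) ∧
    ∀ f : Qpos → ℂ, (Summable fun q => ‖f q‖ * ωQ q) →
      opQ ωQ f = wnormQ ωQ f :=
  ⟨ωQ_pos, ωQ_add_le, wtQ_ωQ, fun _ hf => opQ_ωQ hf⟩
end
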